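/- Let d be even, let Γ_a (a ∈ Fin d) be a gamma-matrix representation of size N, and let G : (Fin n → Fin d) → ℂ and G' : (Fin m → Fin d) → ℂ be alternating. Then Σ_{a : Fin n → Fin d} Σ_{b : Fin m → Fin d} G(a) · G'(b) · (∏_{i} η(a_i)) · (∏_{j} η(b_j)) · Tr(Γ_{a₁}⋯Γ_{aₙ} · Γ_{b₁}⋯Γ_{bₘ}) equals 0 when n ≠ m, and equals (−1)^{n(n−1)/2} · n! · N · Σ_{a} G(a) · G'(a) · ∏_{i} η(a_i) when n = m. (This is the trace orthogonality of contracted antisymmetrized gamma products used to prove Lemmas 4 and 5 of Appendix C.) -/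

import Mathlib

open scoped BigOperators

/-- The ordered product `Γ_{a₁} ⋯ Γ_{a_k}` of gamma matrices. -/
noncomputable def gammaProd {d N : ℕ} (Γ : Fin d → Matrix (Fin N) (Fin N) ℂ)
    {k : ℕ} (a : Fin k → Fin d) : Matrix (Fin N) (Fin N) ℂ :=
  (List.ofFn fun i => Γ (a i)).prod

section GammaMatrices

variable {d N : ℕ} {η : Fin d → ℂ} {Γ : Fin d → Matrix (Fin N) (Fin N) ℂ}

theorem gammaProd_eq_prod_map {k : ℕ} (a : Fin k → Fin d) :
    gammaProd Γ a = ((List.ofFn a).map Γ).prod := by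
  rw [gammaProd, List.map_ofFn]
  rfl

theorem gammaProd_succ {k : ℕ} (a : Fin (k + 1) → Fin d) :
    gammaProd Γ a = Γ (a 0) * gammaProd Γ (fun i => a i.succ) := by
  simp [gammaProd, List.ofFn_succ]

theorem gamma_anticomm
    (hΓ : ∀ a b, Γ a * Γ b + Γ b * Γ a = if a = b then (2 * η a) • 1 else 0)
    {a b : Fin d} (hab : a ≠ b) : Γ a * Γ b = -(Γ b * Γ a) := by
  have h := hΓ a b
  rw [if_neg hab] at h
  exact eq_neg_of_add_eq_zero_left h

theorem gamma_mul_self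
    (hΓ : ∀ a b, Γ a * Γ b + Γ b * Γ a = if a = b then (2 * η a) • 1 else 0)
    (a : Fin d) : Γ a * Γ a = η a • 1 := by
  have h := hΓ a a
  rw [if_pos rfl, ← two_smul ℂ, mul_smul] at h
  exact smul_right_injective _ (two_ne_zero (α := ℂ)) h

theorem gamma_mul_prod_map
    (hΓ : ∀ a b, Γ a * Γ b + Γ b * Γ a = if a = b then (2 * η a) • 1 else 0)
    (c : Fin d) (l : List (Fin d)) :
    Γ c * (l.map Γ).prod = (-1 : ℂ) ^ (l.length + l.count c) • ((l.map Γ).prod * Γ c) := by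
  induction l with
  | nil => simp
  | cons x l ih =>
    rw [List.map_cons, List.prod_cons, List.length_cons]
    by_cases hx : x = c
    · subst hx
      rw [List.count_cons_self, mul_assoc, ih, mul_smul_comm]
      congr 1
      ring
    · rw [List.count_cons_of_ne hx, ← mul_assoc, gamma_anticomm hΓ (Ne.symm hx),
        neg_mul, mul_assoc, ih, mul_smul_comm, ← neg_smul, mul_assoc]
      congr 1
      ring

theorem even_count_of_trace_ne_zero (hd : Even d) (hη : ∀ a, η a = 1 ∨ η a = -1)
    (hΓ : ∀ a b, Γ a * Γ b + Γ b * Γ a = if a = b then (2 * η a) • 1 else 0)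
    (l : List (Fin d)) (hl : ((l.map Γ).prod).trace ≠ 0) (c : Fin d) :
    Even (l.count c) := by
  have key : ∀ c, Even (l.length + l.count c) := by
    intro c
    by_contra hc
    have h := gamma_mul_prod_map hΓ c l
    rw [(Nat.not_even_iff_odd.mp hc).neg_one_pow, neg_one_smul] at h
    have h1 : (Γ c * (Γ c * (l.map Γ).prod)).trace = -(Γ c * ((l.map Γ).prod * Γ c)).trace := by
      rw [h, mul_neg, Matrix.trace_neg]
    rw [← mul_assoc (Γ c) _ (Γ c), Matrix.trace_mul_comm _ (Γ c), ← mul_assoc,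
      gamma_mul_self hΓ, smul_mul_assoc, one_mul, Matrix.trace_smul, smul_eq_mul] at h1
    have h2 : η c * ((l.map Γ).prod).trace = 0 := self_eq_neg.mp h1
    rcases mul_eq_zero.mp h2 with h3 | h3
    · rcases hη c with h4 | h4 <;> simp [h4] at h3
    · exact hl h3
  have hsum : ∑ c, l.count c = l.length := by
    have := Multiset.sum_count_eq_card (s := Finset.univ) (m := (l : Multiset (Fin d)))
      (fun _ _ => Finset.mem_univ _)
    simpa using this
  have hlen : Even l.length := by
    have h1 : Even (∑ c, (l.length + l.count c)) := Finset.even_sum _ fun c _ => key c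
    rw [Finset.sum_add_distrib, hsum, Finset.sum_const, Finset.card_univ, Fintype.card_fin,
      smul_eq_mul] at h1
    exact (Nat.even_add.mp h1).mp (hd.mul_right _)
  exact (Nat.even_add.mp (key c)).mp hlen

theorem perm_of_trace_ne_zero (hd : Even d) (hη : ∀ a, η a = 1 ∨ η a = -1)
    (hΓ : ∀ a b, Γ a * Γ b + Γ b * Γ a = if a = b then (2 * η a) • 1 else 0)
    {n m : ℕ} {a : Fin n → Fin d} {b : Fin m → Fin d}
    (ha : Function.Injective a) (hb : Function.Injective b)
    (h : (gammaProd Γ a * gammaProd Γ b).trace ≠ 0) :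
    (List.ofFn a).Perm (List.ofFn b) := by
  rw [gammaProd_eq_prod_map, gammaProd_eq_prod_map, ← List.prod_append, ← List.map_append] at h
  rw [List.perm_iff_count]
  intro c
  have h1 := even_count_of_trace_ne_zero hd hη hΓ _ h c
  rw [List.count_append] at h1
  have h2 := List.nodup_iff_count_le_one.mp (List.nodup_ofFn.mpr ha) c
  have h3 := List.nodup_iff_count_le_one.mp (List.nodup_ofFn.mpr hb) c
  obtain ⟨k, hk⟩ := h1
  omega

theorem gammaProd_comp_swap_succ
    (hΓ : ∀ a b, Γ a * Γ b + Γ b * Γ a = if a = b then (2 * η a) • 1 else 0)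
    {n : ℕ} (i : Fin n) (a : Fin (n + 1) → Fin d) (ha : Function.Injective a) :
    gammaProd Γ (a ∘ Equiv.swap i.castSucc i.succ) = -gammaProd Γ a := by
  induction n with
  | zero => exact i.elim0
  | succ n ih =>
    refine Fin.cases ?_ (fun j => ?_) i
    · have h2 : ∀ k : Fin n, Equiv.swap (0 : Fin (n + 2)) 1 k.succ.succ = k.succ.succ := by
        intro k
        apply Equiv.swap_apply_of_ne_of_ne <;> simp [Fin.ext_iff]
      have h01 : a 0 ≠ a 1 := fun h => by simpa using ha h
      rw [gammaProd_succ, gammaProd_succ, gammaProd_succ a, gammaProd_succ]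
      simp only [Fin.castSucc_zero, Fin.succ_zero_eq_one, Function.comp_apply, h2,
        Equiv.swap_apply_left, Equiv.swap_apply_right]
      rw [← mul_assoc, ← mul_assoc, gamma_anticomm hΓ h01, neg_mul, neg_neg]
    · have h0 : Equiv.swap j.succ.castSucc j.succ.succ 0 = 0 := by
        apply Equiv.swap_apply_of_ne_of_ne <;> simp [Fin.ext_iff]
      have h1 : (fun k : Fin (n + 1) => (a ∘ Equiv.swap j.succ.castSucc j.succ.succ) k.succ)
          = (fun k => a k.succ) ∘ Equiv.swap j.castSucc j.succ := by
        funext k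
        simp only [Function.comp_apply, ← Fin.succ_castSucc]
        rw [(Fin.succ_injective _).swap_apply]
      rw [gammaProd_succ, gammaProd_succ a, h1,
        ih j (fun k => a k.succ) (ha.comp (Fin.succ_injective _)),
        Function.comp_apply, h0, mul_neg]

theorem gammaProd_comp_perm
    (hΓ : ∀ a b, Γ a * Γ b + Γ b * Γ a = if a = b then (2 * η a) • 1 else 0)
    {n : ℕ} (σ : Equiv.Perm (Fin n)) (a : Fin n → Fin d) (ha : Function.Injective a) :
    gammaProd Γ (a ∘ σ) = ((σ.sign : ℤ) : ℂ) • gammaProd Γ a := by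
  cases n with
  | zero => simp [gammaProd, Subsingleton.elim σ 1]
  | succ n =>
    have hσ : σ ∈ Submonoid.closure
        (Set.range fun i : Fin n => Equiv.swap i.castSucc i.succ) := by
      rw [Equiv.Perm.mclosure_swap_castSucc_succ]
      trivial
    induction hσ using Submonoid.closure_induction generalizing a with
    | mem σ h =>
      obtain ⟨i, rfl⟩ := h
      rw [gammaProd_comp_swap_succ hΓ i a ha,
        Equiv.Perm.sign_swap (Fin.castSucc_lt_succ).ne]
      simp
    | one => simp
    | mul σ τ _ _ h1 h2 =>
      rw [Equiv.Perm.coe_mul, ← Function.comp_assoc, h2 _ (ha.comp σ.injective), h1 _ ha,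
        smul_smul]
      simp [mul_comm]

theorem gammaProd_mul_self
    (hΓ : ∀ a b, Γ a * Γ b + Γ b * Γ a = if a = b then (2 * η a) • 1 else 0)
    {n : ℕ} (a : Fin n → Fin d) (ha : Function.Injective a) :
    gammaProd Γ a * gammaProd Γ a = ((-1 : ℂ) ^ (n * (n - 1) / 2) * ∏ i, η (a i)) • 1 := by
  induction n with
  | zero => simp [gammaProd]
  | succ n ih =>
    have hcount : (List.ofFn fun i : Fin n => a i.succ).count (a 0) = 0 := by
      rw [List.count_eq_zero, List.mem_ofFn]
      rintro ⟨i, hi⟩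
      exact Fin.succ_ne_zero i (ha hi)
    have hcomm := gamma_mul_prod_map hΓ (a 0) (List.ofFn fun i : Fin n => a i.succ)
    rw [← gammaProd_eq_prod_map, hcount, List.length_ofFn, add_zero] at hcomm
    have htri : (n + 1) * (n + 1 - 1) / 2 = n * (n - 1) / 2 + n := by
      rw [← Finset.sum_range_id_mul_two, ← Finset.sum_range_id_mul_two,
        Nat.mul_div_cancel _ two_pos, Nat.mul_div_cancel _ two_pos, Finset.sum_range_succ]
    have hcomm' : gammaProd Γ (fun i : Fin n => a i.succ) * Γ (a 0)
        = (-1 : ℂ) ^ n • (Γ (a 0) * gammaProd Γ (fun i : Fin n => a i.succ)) := by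
      rw [hcomm, smul_smul, ← mul_pow]
      simp
    rw [gammaProd_succ, mul_assoc, ← mul_assoc (gammaProd Γ _), hcomm', smul_mul_assoc,
      mul_assoc, ih (fun i => a i.succ) (ha.comp (Fin.succ_injective _)), mul_smul_comm,
      mul_smul_comm, mul_smul_comm, mul_one, gamma_mul_self hΓ, smul_smul, smul_smul,
      Fin.prod_univ_succ, htri, pow_add]
    congr 1
    ring

end GammaMatrices

section Alternating

variable {ι α : Type*} [DecidableEq ι] {G : (ι → α) → ℂ}

theorem eq_zero_of_not_injective_of_swap
    (hG : ∀ (a : ι → α) (i j : ι), i ≠ j → G (a ∘ Equiv.swap i j) = -G a)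
    {a : ι → α} (ha : ¬ Function.Injective a) : G a = 0 := by
  simp only [Function.Injective, not_forall] at ha
  obtain ⟨i, j, hij, hne⟩ := ha
  have h := hG a i j hne
  rw [Equiv.comp_swap_eq_update, hij, Function.update_eq_self, ← hij,
    Function.update_eq_self] at h
  exact self_eq_neg.mp h

theorem apply_comp_perm_of_swap [Fintype ι]
    (hG : ∀ (a : ι → α) (i j : ι), i ≠ j → G (a ∘ Equiv.swap i j) = -G a)
    (σ : Equiv.Perm ι) (a : ι → α) : G (a ∘ σ) = ((σ.sign : ℤ) : ℂ) * G a := by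
  induction σ using Equiv.Perm.swap_induction_on generalizing a with
  | one => simp
  | swap_mul σ i j hij ih =>
    rw [Equiv.Perm.coe_mul, ← Function.comp_assoc, ih, hG a i j hij, Equiv.Perm.sign_mul,
      Equiv.Perm.sign_swap hij]
    simp

end Alternating

theorem exists_perm_of_ofFn_perm {α : Type*} {n : ℕ} {a b : Fin n → α}
    (hb : Function.Injective b) (h : (List.ofFn a).Perm (List.ofFn b)) :
    ∃ σ : Equiv.Perm (Fin n), a ∘ σ = b := by
  have hmem : ∀ i, ∃ j, a j = b i := fun i =>
    List.mem_ofFn.mp (h.mem_iff.mpr (List.mem_ofFn.mpr ⟨i, rfl⟩))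
  choose f hf using hmem
  have hinj : Function.Injective f := fun i j hij => hb (by rw [← hf i, ← hf j, hij])
  exact ⟨Equiv.ofBijective f (Finite.injective_iff_bijective.mp hinj), funext hf⟩

/-- trace orthogonality of contracted antisymmetrized gamma products,
used to prove Lemmas 4 and 5 of Appendix C.
For even `d`, a gamma representation `Γ` of size `N`, and alternating `G`, `G'`:
`Σ_{a,b} G(a) G'(b) (∏ η(aᵢ)) (∏ η(bⱼ)) Tr(Γ_{a₁}⋯Γ_{aₙ} Γ_{b₁}⋯Γ_{bₘ})`
vanishes when `n ≠ m` and equals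
`(−1)^{n(n−1)/2} n! N Σ_a G(a) G'(a) ∏ η(aᵢ)` when `n = m`. -/
theorem stmt8 (d N n m : ℕ) (hd : Even d) (η : Fin d → ℂ)
    (hη : ∀ a, η a = 1 ∨ η a = -1)
    (Γ : Fin d → Matrix (Fin N) (Fin N) ℂ)
    (hΓ : ∀ a b, Γ a * Γ b + Γ b * Γ a = if a = b then (2 * η a) • 1 else 0)
    (G : (Fin n → Fin d) → ℂ) (G' : (Fin m → Fin d) → ℂ)
    (hG : ∀ (a : Fin n → Fin d) (i j : Fin n), i ≠ j →
      G (a ∘ Equiv.swap i j) = - G a)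
    (hG' : ∀ (b : Fin m → Fin d) (i j : Fin m), i ≠ j →
      G' (b ∘ Equiv.swap i j) = - G' b) :
    (n ≠ m →
      ∑ a : Fin n → Fin d, ∑ b : Fin m → Fin d,
        G a * G' b * (∏ i, η (a i)) * (∏ j, η (b j))
          * (gammaProd Γ a * gammaProd Γ b).trace = 0)
    ∧ ∀ h : n = m,
      ∑ a : Fin n → Fin d, ∑ b : Fin m → Fin d,
        G a * G' b * (∏ i, η (a i)) * (∏ j, η (b j))
          * (gammaProd Γ a * gammaProd Γ b).trace
      = (-1 : ℂ) ^ (n * (n - 1) / 2) * (n.factorial : ℂ) * (N : ℂ)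
          * ∑ a : Fin n → Fin d,
              G a * G' (fun i => a (Fin.cast h.symm i)) * ∏ i, η (a i) := by
  have hη2 : ∀ {k : ℕ} (a : Fin k → Fin d), (∏ i, η (a i)) * ∏ i, η (a i) = 1 := by
    intro k a
    rw [← Finset.prod_mul_distrib]
    refine Finset.prod_eq_one fun i _ => ?_
    rcases hη (a i) with h | h <;> simp [h]
  have hzero : ∀ (a : Fin n → Fin d) (b : Fin m → Fin d),
      ¬ (List.ofFn a).Perm (List.ofFn b) →
      G a * G' b * (∏ i, η (a i)) * (∏ j, η (b j))
          * (gammaProd Γ a * gammaProd Γ b).trace = 0 := by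
    intro a b hab
    by_cases ha : Function.Injective a
    · by_cases hb : Function.Injective b
      · have h : (gammaProd Γ a * gammaProd Γ b).trace = 0 := by
          by_contra h
          exact hab (perm_of_trace_ne_zero hd hη hΓ ha hb h)
        rw [h, mul_zero]
      · simp [eq_zero_of_not_injective_of_swap hG' hb]
    · simp [eq_zero_of_not_injective_of_swap hG ha]
  refine ⟨fun hnm => ?_, fun h => ?_⟩
  · refine Finset.sum_eq_zero fun a _ => Finset.sum_eq_zero fun b _ => hzero a b fun h => hnm ?_
    simpa using h.length_eq
  · subst h
    rw [Finset.mul_sum]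
    refine Finset.sum_congr rfl fun a _ => ?_
    by_cases ha : Function.Injective a
    · have hinj : Function.Injective fun σ : Equiv.Perm (Fin n) => a ∘ σ := fun σ τ hστ =>
        Equiv.ext fun i => ha (congrFun hστ i)
      rw [← Finset.sum_subset (Finset.subset_univ (Finset.univ.image
        fun σ : Equiv.Perm (Fin n) => a ∘ σ)), Finset.sum_image hinj.injOn]
      · have hterm : ∀ σ : Equiv.Perm (Fin n),
            G a * G' (a ∘ σ) * (∏ i, η (a i)) * (∏ j, η ((a ∘ σ) j))
              * (gammaProd Γ a * gammaProd Γ (a ∘ σ)).trace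
            = (-1 : ℂ) ^ (n * (n - 1) / 2) * N * (G a * G' a * ∏ i, η (a i)) := by
          intro σ
          have hs : ((σ.sign : ℤ) : ℂ) * ((σ.sign : ℤ) : ℂ) = 1 := by
            rcases Int.units_eq_one_or σ.sign with h | h <;> simp [h]
          have hp : ∏ j, η ((a ∘ σ) j) = ∏ i, η (a i) :=
            Equiv.prod_comp σ fun i => η (a i)
          rw [hp, apply_comp_perm_of_swap hG', gammaProd_comp_perm hΓ σ a ha, mul_smul_comm,
            gammaProd_mul_self hΓ a ha, Matrix.trace_smul, Matrix.trace_smul, Matrix.trace_one,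
            Fintype.card_fin, smul_eq_mul, smul_eq_mul]
          linear_combination
            (-1 : ℂ) ^ (n * (n - 1) / 2) * N * (G a * G' a * ∏ i, η (a i)) *
              ((∏ i, η (a i)) * (∏ i, η (a i)) * hs + hη2 a)
        rw [Finset.sum_congr rfl fun σ _ => hterm σ, Finset.sum_const, Finset.card_univ,
          Fintype.card_perm, Fintype.card_fin, nsmul_eq_mul]
        simp only [Fin.cast_eq_self]
        ring
      · intro b _ hb
        refine hzero a b fun h => hb ?_
        obtain ⟨σ, rfl⟩ := exists_perm_of_ofFn_perm
          (List.nodup_ofFn.mp (h.nodup_iff.mp (List.nodup_ofFn.mpr ha))) h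
        exact Finset.mem_image_of_mem _ (Finset.mem_univ σ)
    · simp [eq_zero_of_not_injective_of_swap hG ha]
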